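/- For every p > 2, the length function L is positive on (0, (p/2)^(1/(p−2))), continuous and strictly decreasing on (0, (p/2)^(1/(p−2))], satisfies L((p/2)^(1/(p−2))) = 0, and L(z) → +∞ as z → 0⁺. -/

import Mathlib

open MeasureTheory

/-- `f(t) = t²/2 - tᵖ/p`. -/
noncomputable def f (p t : ℝ) : ℝ := t ^ 2 / 2 - t ^ p / p

namespace LengthFunction

open Set Filter Topology

variable {p : ℝ}

lemma continuous_f (hp : 2 < p) : Continuous (f p) := by
  unfold f
  have : Continuous fun t : ℝ => t ^ p := Real.continuous_rpow_const (by linarith)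
  fun_prop

lemma hasDerivAt_f (hp : 2 < p) (t : ℝ) : HasDerivAt (f p) (t - t ^ (p - 1)) t := by
  have h1 : HasDerivAt (fun t : ℝ => t ^ p) (p * t ^ (p - 1)) t :=
    Real.hasDerivAt_rpow_const (Or.inr (by linarith))
  have h2 := ((hasDerivAt_pow 2 t).div_const 2).sub (h1.div_const p)
  refine h2.congr_deriv ?_
  have : p ≠ 0 := by linarith
  field_simp
  norm_num
  ring

lemma deriv_f (hp : 2 < p) (t : ℝ) : deriv (f p) t = t - t ^ (p - 1) := (hasDerivAt_f hp t).deriv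

lemma rpow_sub_one_eq (t : ℝ) (ht : 0 < t) : t ^ (p - 1) = t * t ^ (p - 2) := by
  rw [show p - 1 = 1 + (p - 2) by ring, Real.rpow_add ht, Real.rpow_one]

lemma f_eq (t : ℝ) (ht : 0 < t) : f p t = t ^ 2 * (1 / 2 - t ^ (p - 2) / p) := by
  have : t ^ p = t ^ 2 * t ^ (p - 2) := by
    rw [← Real.rpow_natCast, ← Real.rpow_add ht]; congr 1; norm_num
  rw [f, this]; ring

lemma lt_rpow_sub_one (hp : 2 < p) {t : ℝ} (ht : 1 < t) : t < t ^ (p - 1) := by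
  simpa using Real.rpow_lt_rpow_of_exponent_lt ht (by linarith : (1 : ℝ) < p - 1)

lemma rpow_sub_one_lt (hp : 2 < p) {t : ℝ} (h0 : 0 < t) (ht : t < 1) : t ^ (p - 1) < t := by
  simpa using Real.rpow_lt_rpow_of_exponent_gt h0 ht (by linarith : (1 : ℝ) < p - 1)

lemma strictMonoOn_f (hp : 2 < p) : StrictMonoOn (f p) (Icc 0 1) := by
  refine strictMonoOn_of_deriv_pos (convex_Icc 0 1) (continuous_f hp).continuousOn fun t ht => ?_
  rw [interior_Icc] at ht
  rw [deriv_f hp]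
  linarith [rpow_sub_one_lt hp ht.1 ht.2]

lemma strictAntiOn_f (hp : 2 < p) : StrictAntiOn (f p) (Ici 1) := by
  refine strictAntiOn_of_deriv_neg (convex_Ici 1) (continuous_f hp).continuousOn fun t ht => ?_
  rw [interior_Ici] at ht
  rw [deriv_f hp]
  linarith [lt_rpow_sub_one hp ht]

lemma hasDerivAt_deriv_f {t : ℝ} (ht : 0 < t) :
    HasDerivAt (fun t => t - t ^ (p - 1)) (1 - (p - 1) * t ^ (p - 2)) t := by
  have h1 : HasDerivAt (fun t : ℝ => t ^ (p - 1)) ((p - 1) * t ^ (p - 1 - 1)) t :=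
    Real.hasDerivAt_rpow_const (Or.inl ht.ne')
  refine ((hasDerivAt_id t).sub h1).congr_deriv ?_
  rw [show p - 1 - 1 = p - 2 by ring]

lemma one_lt_mul_rpow (hp : 2 < p) {t : ℝ} (ht : 1 ≤ t) : 1 < (p - 1) * t ^ (p - 2) := by
  have := Real.one_le_rpow ht (by linarith : 0 ≤ p - 2)
  nlinarith

lemma concaveOn_f (hp : 2 < p) : ConcaveOn ℝ (Ici 1) (f p) := by
  refine AntitoneOn.concaveOn_of_deriv (convex_Ici 1) (continuous_f hp).continuousOn
    (fun t _ => (hasDerivAt_f hp t).differentiableAt.differentiableWithinAt) ?_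
  rw [interior_Ici, funext (deriv_f hp)]
  have hd : ∀ t ∈ Ioi (1 : ℝ), HasDerivAt (fun t : ℝ => t - t ^ (p - 1))
      (1 - (p - 1) * t ^ (p - 2)) t := fun t ht => hasDerivAt_deriv_f (by linarith [mem_Ioi.1 ht])
  refine antitoneOn_of_deriv_nonpos (convex_Ioi 1)
    (fun t ht => (hd t ht).continuousAt.continuousWithinAt)
    (fun t ht => ?_) fun t ht => ?_ <;> rw [interior_Ioi] at ht
  · exact (hd t ht).differentiableAt.differentiableWithinAt
  · rw [(hd t ht).deriv]
    linarith [one_lt_mul_rpow hp (mem_Ioi.1 ht).le]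

lemma f_one_pos (hp : 2 < p) : 0 < f p 1 := by
  have : (1 : ℝ) / p < 1 / 2 := one_div_lt_one_div_of_lt two_pos hp
  simp only [f, Real.one_rpow]
  linarith

lemma one_lt_zero_point (hp : 2 < p) : 1 < (p / 2) ^ (1 / (p - 2)) :=
  Real.one_lt_rpow (by linarith) (one_div_pos.2 (by linarith))

lemma f_zero_point (hp : 2 < p) : f p ((p / 2) ^ (1 / (p - 2))) = 0 := by
  rw [f_eq _ (by linarith [one_lt_zero_point hp]), ← Real.rpow_mul (by linarith),
    one_div_mul_cancel (by linarith), Real.rpow_one]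
  field_simp
  simp

lemma f_pos (hp : 2 < p) {z : ℝ} (hz : z ∈ Ioo (0 : ℝ) ((p / 2) ^ (1 / (p - 2)))) : 0 < f p z := by
  rcases le_total z 1 with h | h
  · have := strictMonoOn_f hp (left_mem_Icc.2 zero_le_one) ⟨hz.1.le, h⟩ hz.1
    rwa [f, Real.zero_rpow (by linarith), zero_div, zero_pow two_ne_zero, zero_div, sub_zero]
      at this
  · have := strictAntiOn_f hp h (one_lt_zero_point hp).le hz.2
    rwa [f_zero_point hp] at this

lemma f_le_f_one (hp : 2 < p) {t : ℝ} (ht : 0 ≤ t) : f p t ≤ f p 1 := by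
  rcases le_total t 1 with h | h
  · exact (strictMonoOn_f hp).monotoneOn ⟨ht, h⟩ (right_mem_Icc.2 zero_le_one) h
  · exact (strictAntiOn_f hp).antitoneOn self_mem_Ici h h

lemma exists_f_eq (hp : 2 < p) {y : ℝ} (hy : y ≤ f p 1) : ∃ t, 1 ≤ t ∧ f p t = y := by
  set r : ℝ := (p * (1 / 2 + |y|)) ^ (1 / (p - 2)) with hr
  have hbase : 1 ≤ p * (1 / 2 + |y|) := by nlinarith [abs_nonneg y]
  have hr1 : 1 ≤ r := Real.one_le_rpow hbase (one_div_pos.2 (by linarith)).le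
  have hfr : f p r ≤ y := by
    have : r ^ (p - 2) = p * (1 / 2 + |y|) := by
      rw [hr, ← Real.rpow_mul (by linarith), one_div_mul_cancel (by linarith), Real.rpow_one]
    rw [f_eq r (by linarith), this, mul_div_cancel_left₀ _ (by linarith)]
    have : |y| ≤ r ^ 2 * |y| := le_mul_of_one_le_left (abs_nonneg y) (one_le_pow₀ hr1)
    linarith [neg_abs_le y]
  obtain ⟨t, ht, h⟩ := intermediate_value_Icc' hr1 (continuous_f hp).continuousOn ⟨hfr, hy⟩
  exact ⟨t, ht.1, h⟩

/-- The inverse of `f p` restricted to `[1, ∞)`. -/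
noncomputable def fInv (p y : ℝ) : ℝ := Function.invFunOn (f p) (Ici 1) y

lemma one_le_fInv (hp : 2 < p) {y : ℝ} (hy : y ≤ f p 1) : 1 ≤ fInv p y :=
  Function.invFunOn_mem (exists_f_eq hp hy)

lemma f_fInv (hp : 2 < p) {y : ℝ} (hy : y ≤ f p 1) : f p (fInv p y) = y :=
  Function.invFunOn_eq (exists_f_eq hp hy)

lemma fInv_f (hp : 2 < p) {t : ℝ} (ht : 1 ≤ t) : fInv p (f p t) = t :=
  have h := f_le_f_one hp (zero_le_one.trans ht)
  (strictAntiOn_f hp).injOn (one_le_fInv hp h) ht (f_fInv hp h)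

lemma strictAntiOn_fInv (hp : 2 < p) : StrictAntiOn (fInv p) (Iic (f p 1)) := by
  intro x hx y hy hxy
  rw [← (strictAntiOn_f hp).lt_iff_gt (one_le_fInv hp hx) (one_le_fInv hp hy), f_fInv hp hx,
    f_fInv hp hy]
  exact hxy

lemma one_lt_fInv (hp : 2 < p) {y : ℝ} (hy : y < f p 1) : 1 < fInv p y := by
  have := strictAntiOn_fInv hp hy.le self_mem_Iic hy
  rwa [fInv_f hp le_rfl] at this

lemma fInv_image_Ioo (hp : 2 < p) {a b : ℝ} (hab : a ≤ b) (hb : b ≤ f p 1) :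
    fInv p '' Ioo a b = Ioo (fInv p b) (fInv p a) := by
  ext t
  constructor
  · rintro ⟨y, hy, rfl⟩
    have hy1 : y ≤ f p 1 := hy.2.le.trans hb
    exact ⟨strictAntiOn_fInv hp hy1 hb hy.2, strictAntiOn_fInv hp (hab.trans hb) hy1 hy.1⟩
  · intro ht
    have ht1 : 1 ≤ t := (one_le_fInv hp hb).trans ht.1.le
    refine ⟨f p t, ⟨?_, ?_⟩, fInv_f hp ht1⟩
    · have := strictAntiOn_f hp ht1 (one_le_fInv hp (hab.trans hb)) ht.2
      rwa [f_fInv hp (hab.trans hb)] at this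
    · have := strictAntiOn_f hp (one_le_fInv hp hb) ht1 ht.1
      rwa [f_fInv hp hb] at this

lemma continuousAt_fInv (hp : 2 < p) {y : ℝ} (hy : y < f p 1) : ContinuousAt (fInv p) y := by
  have h : ContinuousAt (fun y => - fInv p y) y := by
    refine StrictMonoOn.continuousAt_of_image_mem_nhds (s := Iio (f p 1))
      (fun a ha b hb hab => 
        neg_lt_neg (strictAntiOn_fInv hp (mem_Iio.1 ha).le (mem_Iio.1 hb).le hab))
      (Iio_mem_nhds hy) ?_
    refine mem_of_superset (Iio_mem_nhds (neg_lt_neg (one_lt_fInv hp hy))) fun t ht => ?_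
    have ht1 : 1 < -t := by linarith [mem_Iio.1 ht]
    exact ⟨f p (-t), strictAntiOn_f hp self_mem_Ici ht1.le ht1, by
      simp [fInv_f hp ht1.le]⟩
  exact h.neg.congr (.of_forall fun y => neg_neg _)

/-- The reciprocal `-1 / f' (t)` at the point `t ≥ 1` where `f t = y`. -/
noncomputable def q (p y : ℝ) : ℝ := (fInv p y ^ (p - 1) - fInv p y)⁻¹

lemma q_pos (hp : 2 < p) {y : ℝ} (hy : y < f p 1) : 0 < q p y :=
  inv_pos.2 (sub_pos.2 (lt_rpow_sub_one hp (one_lt_fInv hp hy)))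

lemma hasDerivAt_fInv (hp : 2 < p) {y : ℝ} (hy : y < f p 1) :
    HasDerivAt (fInv p) (-q p y) y := by
  have h0 := lt_rpow_sub_one hp (one_lt_fInv hp hy)
  have := HasDerivAt.of_local_left_inverse (continuousAt_fInv hp hy) (hasDerivAt_f hp _)
    (by linarith) ((eventually_lt_nhds hy).mono fun x hx => f_fInv hp hx.le)
  refine this.congr_deriv ?_
  rw [q, ← inv_neg, neg_sub]

lemma neg_three_mul_f_nonpos (hp : 2 < p) {z : ℝ}
    (hz : z ∈ Ioc (0 : ℝ) ((p / 2) ^ (1 / (p - 2)))) : -3 * f p z ≤ 0 := by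
  rcases hz.2.lt_or_eq with h | h
  · linarith [f_pos hp ⟨hz.1, h⟩]
  · rw [h, f_zero_point hp, mul_zero]

lemma lt_fInv (hp : 2 < p) {z : ℝ} (hz : z ∈ Ioo (0 : ℝ) ((p / 2) ^ (1 / (p - 2)))) :
    max z 1 < fInv p (-3 * f p z) := by
  have h0 := f_pos hp hz
  have h1 := f_one_pos hp
  have := strictAntiOn_fInv hp (by linarith : -3 * f p z ≤ f p 1) h1.le (by linarith)
  have hZ := fInv_f hp (one_lt_zero_point hp).le
  rw [f_zero_point hp] at hZ
  rw [hZ] at this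
  exact (max_lt hz.2 (one_lt_zero_point hp)).trans this

/-- The radicand lies above the chord joining its values `4 f z` and `0` at the endpoints. -/
lemma le_radicand (hp : 2 < p) {z s : ℝ} (hz : z ∈ Ioo (0 : ℝ) ((p / 2) ^ (1 / (p - 2))))
    (hs : s ∈ Icc (0 : ℝ) 1) :
    4 * f p z * (1 - s) ≤ f p (z + (fInv p (-3 * f p z) - z) * s) + 3 * f p z := by
  have h0 := f_pos hp hz
  have hw := lt_fInv hp hz
  have hfw : f p (fInv p (-3 * f p z)) = -3 * f p z := f_fInv hp (by linarith [f_one_pos hp])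
  set w := fInv p (-3 * f p z)
  have hzw : z < w := (le_max_left _ _).trans_lt hw
  have hzt : z ≤ z + (w - z) * s := by nlinarith [hs.1]
  have htw : z + (w - z) * s ≤ w := by nlinarith [hs.2]
  have hst : (w - z) * (1 - s) = w - (z + (w - z) * s) := by ring
  set t := z + (w - z) * s
  rcases le_total t 1 with ht | ht
  · have := (strictMonoOn_f hp).monotoneOn ⟨hz.1.le, hzt.trans ht⟩ ⟨hz.1.le.trans hzt, ht⟩ hzt
    nlinarith [hs.1]
  · set m := max z 1
    have hmt : m ≤ t := max_le hzt ht
    have hfm : f p z ≤ f p m := by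
      rcases le_total z 1 with h | h
      · rw [show m = 1 from max_eq_right h]
        exact f_le_f_one hp hz.1.le
      · rw [show m = z from max_eq_left h]
    have hmw : 0 < w - m := sub_pos.2 hw
    have hc := (concaveOn_f hp).2 (show m ∈ Ici 1 from le_max_right z 1)
      (show w ∈ Ici 1 from (le_max_right z 1).trans hw.le)
      (div_nonneg (sub_nonneg.2 htw) hmw.le) (div_nonneg (sub_nonneg.2 hmt) hmw.le)
      (by field_simp; ring)
    have hcomb : ((w - t) / (w - m)) • m + ((t - m) / (w - m)) • w = t := by
      simp only [smul_eq_mul]; field_simp; ring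
    rw [hcomb, hfw] at hc
    simp only [smul_eq_mul] at hc
    have hsum : (t - m) / (w - m) = 1 - (w - t) / (w - m) := by field_simp; ring
    have hle : 1 - s ≤ (w - t) / (w - m) := by
      rw [le_div_iff₀ hmw, ← hst, mul_comm]
      exact mul_le_mul_of_nonneg_right (by linarith [le_max_left z 1]) (by linarith [hs.2])
    rw [hsum] at hc
    nlinarith [hs.2]

lemma intervalIntegrable_inv_sqrt : IntervalIntegrable (fun s : ℝ => (√s)⁻¹) volume 0 1 := by
  refine (intervalIntegral.intervalIntegrable_rpow' (r := -(1 / 2)) (by norm_num)).congr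
    fun s hs => ?_
  rw [uIoc_of_le zero_le_one] at hs
  rw [Real.rpow_neg hs.1.le, Real.sqrt_eq_rpow]

lemma intervalIntegrable_inv_sqrt_one_sub :
    IntervalIntegrable (fun s : ℝ => (√(1 - s))⁻¹) volume 0 1 := by
  simpa using (intervalIntegrable_inv_sqrt.comp_sub_left 1).symm

/-- The integral in the length function. -/
noncomputable def lengthIntegral (p z : ℝ) : ℝ :=
  ∫ t in z..fInv p (-3 * f p z), 1 / √(f p t + 3 * f p z)

/-- The integrand of the length function, reparametrized affinely by `[0, 1]`. -/
noncomputable def unitIntegrand (p z s : ℝ) : ℝ :=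
  1 / √(f p (z + (fInv p (-3 * f p z) - z) * s) + 3 * f p z)

lemma lengthIntegral_eq (p z : ℝ) :
    lengthIntegral p z = (fInv p (-3 * f p z) - z) * ∫ s in (0 : ℝ)..1, unitIntegrand p z s := by
  have := intervalIntegral.smul_integral_comp_add_mul (a := 0) (b := 1)
    (fun t => 1 / √(f p t + 3 * f p z)) (fInv p (-3 * f p z) - z) z
  simp only [mul_zero, add_zero, mul_one, add_sub_cancel, smul_eq_mul] at this
  exact this.symm

lemma unitIntegrand_nonneg (p z s : ℝ) : 0 ≤ unitIntegrand p z s := by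
  unfold unitIntegrand; positivity

lemma unitIntegrand_le (hp : 2 < p) {z s : ℝ} (hz : z ∈ Ioo (0 : ℝ) ((p / 2) ^ (1 / (p - 2))))
    (hs : s ∈ Ioo (0 : ℝ) 1) : unitIntegrand p z s ≤ (2 * √(f p z))⁻¹ * (√(1 - s))⁻¹ := by
  have h0 := f_pos hp hz
  have h1 : 0 < 1 - s := sub_pos.2 hs.2
  have h4 : √4 = 2 := by rw [show (4 : ℝ) = 2 ^ 2 by norm_num, Real.sqrt_sq two_pos.le]
  rw [← mul_inv, unitIntegrand, one_div]
  refine inv_anti₀ (by positivity) ?_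
  calc 2 * √(f p z) * √(1 - s) = √(4 * f p z * (1 - s)) := by
        rw [Real.sqrt_mul (by positivity), Real.sqrt_mul (by positivity), h4]
    _ ≤ _ := Real.sqrt_le_sqrt (le_radicand hp hz (Ioo_subset_Icc_self hs))

lemma measurable_unitIntegrand (hp : 2 < p) (z : ℝ) : Measurable (unitIntegrand p z) := by
  have := (continuous_f hp).measurable
  unfold unitIntegrand
  fun_prop

lemma intervalIntegrable_unitIntegrand (hp : 2 < p) {z : ℝ}
    (hz : z ∈ Ioo (0 : ℝ) ((p / 2) ^ (1 / (p - 2)))) :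
    IntervalIntegrable (unitIntegrand p z) volume 0 1 := by
  have hb := intervalIntegrable_inv_sqrt_one_sub.const_mul (2 * √(f p z))⁻¹
  rw [intervalIntegrable_iff_integrableOn_Ioo_of_le zero_le_one] at hb ⊢
  refine Integrable.mono' hb (measurable_unitIntegrand hp z).aestronglyMeasurable ?_
  refine (ae_restrict_iff' measurableSet_Ioo).2 (.of_forall fun s hs => ?_)
  rw [Real.norm_of_nonneg (unitIntegrand_nonneg p z s)]
  exact unitIntegrand_le hp hz hs

lemma integrable_integrand (hp : 2 < p) {z : ℝ}
    (hz : z ∈ Ioo (0 : ℝ) ((p / 2) ^ (1 / (p - 2)))) :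
    IntervalIntegrable (fun t => 1 / √(f p t + 3 * f p z)) volume z (fInv p (-3 * f p z)) := by
  have hd : fInv p (-3 * f p z) - z ≠ 0 :=
    (sub_pos.2 ((le_max_left z 1).trans_lt (lt_fInv hp hz))).ne'
  have h := ((intervalIntegrable_unitIntegrand hp hz).comp_mul_left
    (c := (fInv p (-3 * f p z) - z)⁻¹)).comp_sub_right z
  simp only [div_inv_eq_mul, zero_mul, zero_add, one_mul, sub_add_cancel] at h
  refine h.congr fun t _ => ?_
  rw [unitIntegrand, mul_inv_cancel_left₀ hd, add_sub_cancel]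

lemma continuousAt_fInv_comp_f (hp : 2 < p) {z : ℝ}
    (hz : z ∈ Ioc (0 : ℝ) ((p / 2) ^ (1 / (p - 2)))) :
    ContinuousAt (fun z => fInv p (-3 * f p z)) z := by
  have h1 : ContinuousAt (fun z => -3 * f p z) z :=
    (continuous_const.mul (continuous_f hp)).continuousAt
  exact ContinuousAt.comp (f := fun z => -3 * f p z) (continuousAt_fInv hp
    (by linarith [neg_three_mul_f_nonpos hp hz, f_one_pos hp])) h1

lemma continuousAt_lengthIntegral (hp : 2 < p) {z : ℝ}
    (hz : z ∈ Ioo (0 : ℝ) ((p / 2) ^ (1 / (p - 2)))) : ContinuousAt (lengthIntegral p) z := by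
  rw [funext (lengthIntegral_eq p)]
  have hwc := continuousAt_fInv_comp_f hp (Ioo_subset_Ioc_self hz)
  refine (hwc.sub continuousAt_id).mul ?_
  have h0 := f_pos hp hz
  have hne : ∀ᵐ s : ℝ, s ≠ 1 := by simp [ae_iff]
  refine intervalIntegral.continuousAt_of_dominated_interval
    (bound := fun s => (2 * √(f p z / 2))⁻¹ * (√(1 - s))⁻¹)
    (.of_forall fun x => (measurable_unitIntegrand hp x).aestronglyMeasurable) ?_
    (intervalIntegrable_inv_sqrt_one_sub.const_mul _) ?_
  · filter_upwards [Ioo_mem_nhds hz.1 hz.2,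
      (continuous_f hp).continuousAt.eventually (lt_mem_nhds (half_lt_self h0))] with x hx hfx
    filter_upwards [hne] with s hs1 hs
    rw [uIoc_of_le zero_le_one] at hs
    rw [Real.norm_of_nonneg (unitIntegrand_nonneg p x s)]
    refine (unitIntegrand_le hp hx ⟨hs.1, lt_of_le_of_ne hs.2 hs1⟩).trans ?_
    gcongr
  · filter_upwards [hne] with s hs1 hs
    rw [uIoc_of_le zero_le_one] at hs
    have hpos := le_radicand hp hz ⟨hs.1.le, hs.2⟩
    have h1s : 0 < 1 - s := sub_pos.2 (lt_of_le_of_ne hs.2 hs1)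
    have hpos' : 0 < f p (z + (fInv p (-3 * f p z) - z) * s) + 3 * f p z :=
      lt_of_lt_of_le (by positivity) hpos
    unfold unitIntegrand
    refine continuousAt_const.div ?_ (Real.sqrt_pos.2 hpos').ne'
    refine Real.continuous_sqrt.continuousAt.comp ?_
    refine ContinuousAt.add ?_ (continuous_const.mul (continuous_f hp)).continuousAt
    refine (continuous_f hp).continuousAt.comp ?_
    exact continuousAt_id.add ((hwc.sub continuousAt_id).mul continuousAt_const)

lemma lengthIntegral_zero_point (hp : 2 < p) :
    lengthIntegral p ((p / 2) ^ (1 / (p - 2))) = 0 := by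
  have hZ := fInv_f hp (one_lt_zero_point hp).le
  rw [f_zero_point hp] at hZ
  rw [lengthIntegral, f_zero_point hp, mul_zero, mul_zero, hZ, intervalIntegral.integral_same]

lemma lengthIntegral_nonneg (hp : 2 < p) {z : ℝ}
    (hz : z ∈ Ioo (0 : ℝ) ((p / 2) ^ (1 / (p - 2)))) : 0 ≤ lengthIntegral p z :=
  intervalIntegral.integral_nonneg ((le_max_left z 1).trans (lt_fInv hp hz).le)
    fun t _ => by positivity

lemma lengthIntegral_le (hp : 2 < p) {z : ℝ} (h1 : 1 < z) (hz : z < (p / 2) ^ (1 / (p - 2))) :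
    lengthIntegral p z ≤ 4 * f p z * (z - 1) / (f p 1 - f p z) *
      ((2 * √(f p z))⁻¹ * ∫ s in (0 : ℝ)..1, (√(1 - s))⁻¹) := by
  have hz' : z ∈ Ioo (0 : ℝ) ((p / 2) ^ (1 / (p - 2))) := ⟨by linarith, hz⟩
  have h0 := f_pos hp hz'
  have hw := (le_max_left z 1).trans_lt (lt_fInv hp hz')
  rw [lengthIntegral_eq, ← intervalIntegral.integral_const_mul (2 * √(f p z))⁻¹]
  have hf1 : 0 < f p 1 - f p z := sub_pos.2 (strictAntiOn_f hp self_mem_Ici h1.le h1)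
  refine mul_le_mul ?_ ?_ (intervalIntegral.integral_nonneg zero_le_one
    fun s _ => unitIntegrand_nonneg p z s) (by have := sub_pos.2 h1; positivity)
  · have := (concaveOn_f hp).slope_anti_adjacent self_mem_Ici (show _ ∈ Ici 1 from h1.le.trans hw.le)
      h1 hw
    rw [f_fInv hp (by linarith [f_one_pos hp]), div_le_div_iff₀ (sub_pos.2 hw) (sub_pos.2 h1)]
      at this
    rw [le_div_iff₀ hf1]
    linarith
  · refine intervalIntegral.integral_mono_on_of_le_Ioo zero_le_one
      (intervalIntegrable_unitIntegrand hp hz') (intervalIntegrable_inv_sqrt_one_sub.const_mul _)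
      fun s hs => unitIntegrand_le hp hz' hs

lemma continuousOn_lengthIntegral (hp : 2 < p) :
    ContinuousOn (lengthIntegral p) (Ioc (0 : ℝ) ((p / 2) ^ (1 / (p - 2)))) := by
  intro z hz
  rcases hz.2.lt_or_eq with h | rfl
  · exact (continuousAt_lengthIntegral hp ⟨hz.1, h⟩).continuousWithinAt
  have hZ := one_lt_zero_point hp
  have hfZ := f_zero_point hp
  set Z := (p / 2) ^ (1 / (p - 2))
  set C := ∫ s in (0 : ℝ)..1, (√(1 - s))⁻¹ with hC
  have hC0 : 0 ≤ C := intervalIntegral.integral_nonneg zero_le_one fun s _ => by positivity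
  rw [ContinuousWithinAt, lengthIntegral_zero_point hp]
  have hlim : Tendsto (fun z => 2 * √(f p z) * (z - 1) / (f p 1 - f p z) * C) (𝓝[Ioc 0 Z] Z)
      (𝓝 0) := by
    have hcont : ContinuousAt (fun z => 2 * √(f p z) * (z - 1) / (f p 1 - f p z) * C) Z := by
      have := (continuous_f hp).continuousAt (x := Z)
      have h1 : f p 1 - f p Z ≠ 0 := by rw [hfZ, sub_zero]; exact (f_one_pos hp).ne'
      fun_prop (disch := assumption)
    have := hcont.tendsto
    simp only [hfZ, Real.sqrt_zero, mul_zero, zero_mul, zero_div] at this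
    exact this.mono_left nhdsWithin_le_nhds
  refine tendsto_of_tendsto_of_tendsto_of_le_of_le' tendsto_const_nhds hlim ?_ ?_
  · filter_upwards [self_mem_nhdsWithin] with z hz
    rcases hz.2.lt_or_eq with h | h
    · exact lengthIntegral_nonneg hp ⟨hz.1, h⟩
    · rw [h, lengthIntegral_zero_point hp]
  · filter_upwards [self_mem_nhdsWithin, mem_nhdsWithin_of_mem_nhds (Ioi_mem_nhds hZ)] with z hz hz1
    rcases hz.2.lt_or_eq with h | h
    · refine (lengthIntegral_le hp hz1 h).trans_eq ?_
      have h0 := f_pos hp ⟨hz.1, h⟩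
      have hs : 0 < √(f p z) := Real.sqrt_pos.2 h0
      have hsq : √(f p z) * √(f p z) = f p z := Real.mul_self_sqrt h0.le
      rw [← hC]
      nth_rewrite 1 [← hsq]
      field_simp
      ring
    · rw [h, lengthIntegral_zero_point hp, hfZ]; simp

lemma integral_fInv (hp : 2 < p) {a b : ℝ} (hab : a ≤ b) (hb : b ≤ f p 1) (g : ℝ → ℝ) :
    ∫ t in fInv p b..fInv p a, g t = ∫ y in a..b, q p y * g (fInv p y) := by
  have hanti := strictAntiOn_fInv hp
  have hlt : ∀ y ∈ Ioo a b, y < f p 1 := fun y hy => hy.2.trans_le hb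
  rw [intervalIntegral.integral_of_le (hanti.antitoneOn (hab.trans hb) hb hab),
    intervalIntegral.integral_of_le hab, integral_Ioc_eq_integral_Ioo,
    integral_Ioc_eq_integral_Ioo, ← fInv_image_Ioo hp hab hb,
    integral_image_eq_integral_abs_deriv_smul measurableSet_Ioo
      (fun y hy => (hasDerivAt_fInv hp (hlt y hy)).hasDerivWithinAt)
      (hanti.injOn.mono fun y hy => (hlt y hy).le)]
  refine setIntegral_congr_fun measurableSet_Ioo fun y hy => ?_
  simp only [abs_neg, abs_of_pos (q_pos hp (hlt y hy)), smul_eq_mul]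

lemma intervalIntegrable_fInv_iff (hp : 2 < p) {a b : ℝ} (hab : a ≤ b) (hb : b ≤ f p 1)
    (g : ℝ → ℝ) : IntervalIntegrable g volume (fInv p b) (fInv p a) ↔
      IntervalIntegrable (fun y => q p y * g (fInv p y)) volume a b := by
  have hanti := strictAntiOn_fInv hp
  have hlt : ∀ y ∈ Ioo a b, y < f p 1 := fun y hy => hy.2.trans_le hb
  rw [intervalIntegrable_iff_integrableOn_Ioo_of_le (hanti.antitoneOn (hab.trans hb) hb hab),
    intervalIntegrable_iff_integrableOn_Ioo_of_le hab, ← fInv_image_Ioo hp hab hb,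
    integrableOn_image_iff_integrableOn_abs_deriv_smul measurableSet_Ioo
      (fun y hy => (hasDerivAt_fInv hp (hlt y hy)).hasDerivWithinAt)
      (hanti.injOn.mono fun y hy => (hlt y hy).le)]
  refine integrableOn_congr_fun (fun y hy => ?_) measurableSet_Ioo
  simp only [abs_neg, abs_of_pos (q_pos hp (hlt y hy)), smul_eq_mul]

lemma deriv_sq_add_nonpos (hp : 2 < p) {t : ℝ} (ht : 1 ≤ t) :
    (t - t ^ (p - 1)) ^ 2 + 2 * (f p 1 - f p t) * (1 - (p - 1) * t ^ (p - 2)) ≤ 0 := by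
  have hd : ∀ t ∈ Ici (1 : ℝ), HasDerivAt
      (fun t => (t - t ^ (p - 1)) ^ 2 + 2 * (f p 1 - f p t) * (1 - (p - 1) * t ^ (p - 2)))
      (2 * (f p 1 - f p t) * (-((p - 1) * ((p - 2) * t ^ (p - 2 - 1))))) t := by
    intro t ht
    have ht0 : 0 < t := zero_lt_one.trans_le ht
    have h1 : HasDerivAt (fun t : ℝ => t ^ (p - 2)) ((p - 2) * t ^ (p - 2 - 1)) t :=
      Real.hasDerivAt_rpow_const (Or.inl ht0.ne')
    refine (((hasDerivAt_deriv_f ht0).pow 2).add ((((hasDerivAt_f hp t).const_sub (f p 1)).const_mul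
      2).mul ((h1.const_mul (p - 1)).const_sub 1))).congr_deriv ?_
    push_cast
    ring
  have hanti : AntitoneOn (fun t => (t - t ^ (p - 1)) ^ 2 +
      2 * (f p 1 - f p t) * (1 - (p - 1) * t ^ (p - 2))) (Ici 1) := by
    refine antitoneOn_of_deriv_nonpos (convex_Ici 1)
      (fun t ht => (hd t ht).continuousAt.continuousWithinAt)
      (fun t ht => (hd t (interior_subset ht)).differentiableAt.differentiableWithinAt)
      fun t ht => ?_
    have ht1 : 1 ≤ t := interior_subset ht
    rw [(hd t ht1).deriv]
    have h1 : 0 ≤ f p 1 - f p t := sub_nonneg.2 (f_le_f_one hp (by linarith))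
    have h2 : 0 ≤ (p - 1) * ((p - 2) * t ^ (p - 2 - 1)) :=
      mul_nonneg (by linarith) (mul_nonneg (by linarith) (by positivity))
    nlinarith [mul_nonneg h1 h2]
  simpa using hanti self_mem_Ici ht ht

lemma antitoneOn_gap_div_deriv_sq (hp : 2 < p) :
    AntitoneOn (fun t => (f p 1 - f p t) / (t - t ^ (p - 1)) ^ 2) (Ioi 1) := by
  have hd : ∀ t ∈ Ioi (1 : ℝ), HasDerivAt (fun t => (f p 1 - f p t) / (t - t ^ (p - 1)) ^ 2)
      (((t - t ^ (p - 1)) ^ 2 + 2 * (f p 1 - f p t) * (1 - (p - 1) * t ^ (p - 2))) /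
        (t ^ (p - 1) - t) ^ 3) t := by
    intro t ht
    have h0 : t ^ (p - 1) - t ≠ 0 := (sub_pos.2 (lt_rpow_sub_one hp ht)).ne'
    have h0' : t - t ^ (p - 1) ≠ 0 := by rw [← neg_sub]; exact neg_ne_zero.2 h0
    refine (((hasDerivAt_f hp t).const_sub (f p 1)).div ((hasDerivAt_deriv_f
      (zero_lt_one.trans ht)).pow 2) (pow_ne_zero 2 h0')).congr_deriv ?_
    push_cast
    simp only [Pi.pow_apply]
    rw [div_eq_div_iff (pow_ne_zero 2 (pow_ne_zero 2 h0')) (pow_ne_zero 3 h0)]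
    ring
  refine antitoneOn_of_deriv_nonpos (convex_Ioi 1)
    (fun t ht => (hd t ht).continuousAt.continuousWithinAt)
    (fun t ht => (hd t (interior_subset ht)).differentiableAt.differentiableWithinAt) fun t ht => ?_
  rw [interior_Ioi] at ht
  rw [(hd t ht).deriv]
  exact div_nonpos_of_nonpos_of_nonneg (deriv_sq_add_nonpos hp (mem_Ioi.1 ht).le)
    (pow_nonneg (sub_pos.2 (lt_rpow_sub_one hp ht)).le 3)

lemma sqrt_mul_q_anti (hp : 2 < p) {A B : ℝ} (hA : 0 < A) (hAB : A ≤ B) :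
    √B * q p (f p 1 - B) ≤ √A * q p (f p 1 - A) := by
  have key : ∀ C, 0 < C → √C * q p (f p 1 - C) = √((f p 1 - f p (fInv p (f p 1 - C))) /
      (fInv p (f p 1 - C) - fInv p (f p 1 - C) ^ (p - 1)) ^ 2) := by
    intro C hC
    have := lt_rpow_sub_one hp (one_lt_fInv hp (by linarith : f p 1 - C < f p 1))
    rw [f_fInv hp (by linarith), sub_sub_cancel, Real.sqrt_div hC.le, Real.sqrt_sq_eq_abs,
      abs_sub_comm, abs_of_pos (sub_pos.2 this), q, div_eq_mul_inv]
  rw [key A hA, key B (hA.trans_le hAB)]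
  exact Real.sqrt_le_sqrt (antitoneOn_gap_div_deriv_sq hp (one_lt_fInv hp (by linarith))
    (one_lt_fInv hp (by linarith)) ((strictAntiOn_fInv hp).antitoneOn
      (by simp [(hA.trans_le hAB).le]) (by simp [hA.le]) (by linarith)))

lemma affine_integrand (hp : 2 < p) {a b c s : ℝ} (hab : a < b) (hb : b ≤ f p 1) (hac : a + c = 0)
    (hs : s ∈ Ioo (0 : ℝ) 1) :
    (b - a) * (q p (a + (b - a) * s) * (1 / √(f p (fInv p (a + (b - a) * s)) + c))) =
      √(b - a) * q p (a + (b - a) * s) * (√s)⁻¹ := by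
  have h0 : 0 < b - a := sub_pos.2 hab
  have hy : a + (b - a) * s ≤ f p 1 := by nlinarith [hs.2]
  have hs0 : 0 < √s := Real.sqrt_pos.2 hs.1
  have hb0 : 0 < √(b - a) := Real.sqrt_pos.2 h0
  rw [f_fInv hp hy, show a + (b - a) * s + c = (b - a) * s by linarith, Real.sqrt_mul h0.le]
  nth_rewrite 1 [← Real.mul_self_sqrt h0.le]
  field_simp

lemma integral_radicand (hp : 2 < p) {a b c : ℝ} (hab : a < b) (hb : b ≤ f p 1) (hac : a + c = 0) :
    ∫ t in fInv p b..fInv p a, 1 / √(f p t + c) =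
      ∫ s in (0 : ℝ)..1, √(b - a) * q p (a + (b - a) * s) * (√s)⁻¹ := by
  have h := intervalIntegral.smul_integral_comp_add_mul (a := 0) (b := 1)
    (fun y => q p y * (1 / √(f p (fInv p y) + c))) (b - a) a
  simp only [mul_zero, add_zero, mul_one, add_sub_cancel, smul_eq_mul] at h
  rw [integral_fInv hp hab.le hb, ← h, ← intervalIntegral.integral_const_mul]
  refine intervalIntegral.integral_congr_Ioo_of_le zero_le_one fun s hs => ?_
  exact affine_integrand hp hab hb hac hs

lemma intervalIntegrable_radicand (hp : 2 < p) {a b c : ℝ} (hab : a < b) (hb : b ≤ f p 1)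
    (hac : a + c = 0)
    (h : IntervalIntegrable (fun t => 1 / √(f p t + c)) volume (fInv p b) (fInv p a)) :
    IntervalIntegrable (fun s => √(b - a) * q p (a + (b - a) * s) * (√s)⁻¹) volume 0 1 := by
  have h0 : b - a ≠ 0 := (sub_pos.2 hab).ne'
  have h := (((intervalIntegrable_fInv_iff hp hab.le hb _).1 h).comp_add_left a).comp_mul_left
    (c := b - a)
  simp only [sub_self, zero_div, div_self h0] at h
  have h := h.const_mul (b - a)
  rw [intervalIntegrable_iff_integrableOn_Ioo_of_le zero_le_one] at h ⊢
  exact h.congr_fun (fun s hs => affine_integrand hp hab hb hac hs) measurableSet_Ioo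

lemma outer_integral_anti (hp : 2 < p) {c d : ℝ} (hc : 0 ≤ c) (hcd : c < d)
    (hci : IntervalIntegrable (fun t => 1 / √(f p t + c)) volume 1 (fInv p (-c)))
    (hdi : IntervalIntegrable (fun t => 1 / √(f p t + d)) volume 1 (fInv p (-d))) :
    ∫ t in (1 : ℝ)..fInv p (-d), 1 / √(f p t + d) ≤
      ∫ t in (1 : ℝ)..fInv p (-c), 1 / √(f p t + c) := by
  have h1 : fInv p (f p 1) = 1 := fInv_f hp le_rfl
  have h0 := f_one_pos hp
  have hcl : -c < f p 1 := by linarith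
  have hdl : -d < f p 1 := by linarith
  have hce := integral_radicand hp hcl le_rfl (neg_add_cancel c)
  have hde := integral_radicand hp hdl le_rfl (neg_add_cancel d)
  rw [h1] at hce hde
  rw [hce, hde]
  refine intervalIntegral.integral_mono_on_of_le_Ioo zero_le_one
    (intervalIntegrable_radicand hp hdl le_rfl (neg_add_cancel d) (by rwa [h1]))
    (intervalIntegrable_radicand hp hcl le_rfl (neg_add_cancel c) (by rwa [h1])) fun s hs => ?_
  have hs1 : 0 < 1 - s := sub_pos.2 hs.2
  have hle := sqrt_mul_q_anti hp (A := (f p 1 - -c) * (1 - s)) (B := (f p 1 - -d) * (1 - s))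
    (mul_pos (by linarith) hs1) (mul_le_mul_of_nonneg_right (by linarith) hs1.le)
  rw [Real.sqrt_mul (by linarith), Real.sqrt_mul (by linarith),
    show f p 1 - (f p 1 - -d) * (1 - s) = -d + (f p 1 - -d) * s by ring,
    show f p 1 - (f p 1 - -c) * (1 - s) = -c + (f p 1 - -c) * s by ring] at hle
  refine mul_le_mul_of_nonneg_right (le_of_mul_le_mul_right ?_ (Real.sqrt_pos.2 hs1))
    (by positivity)
  linarith

lemma strictAntiOn_lengthIntegral_Ioc (hp : 2 < p) :
    StrictAntiOn (lengthIntegral p) (Ioc 0 1) := by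
  have hZ := one_lt_zero_point hp
  have hmem : ∀ x ∈ Ioc (0 : ℝ) 1, x ∈ Ioo (0 : ℝ) ((p / 2) ^ (1 / (p - 2))) :=
    fun x hx => ⟨hx.1, hx.2.trans_lt hZ⟩
  intro x hx y hy hxy
  have hw : ∀ z ∈ Ioc (0 : ℝ) 1, 1 < fInv p (-3 * f p z) := fun z hz =>
    (le_max_right z 1).trans_lt (lt_fInv hp (hmem z hz))
  have hi : ∀ z ∈ Ioc (0 : ℝ) 1, ∀ a ∈ Icc z (fInv p (-3 * f p z)), ∀ b ∈ Icc z (fInv p (-3 * f p z)),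
      IntervalIntegrable (fun t => 1 / √(f p t + 3 * f p z)) volume a b := fun z hz a ha b hb =>
    (integrable_integrand hp (hmem z hz)).mono_set (by
      rw [uIcc_of_le (hz.2.trans (hw z hz).le)]
      exact (convex_Icc _ _).ordConnected.uIcc_subset ha hb)
  have hx0 := f_pos hp (hmem x hx)
  have hy0 := f_pos hp (hmem y hy)
  have hfxy : f p x < f p y := strictMonoOn_f hp ⟨hx.1.le, hx.2⟩ ⟨hy.1.le, hy.2⟩ hxy
  have hwx := (hw x hx).le
  have hwy := (hw y hy).le
  have hix1 := hi x hx x ⟨le_rfl, hx.2.trans hwx⟩ y ⟨hxy.le, hy.2.trans hwx⟩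
  have hix2 := hi x hx y ⟨hxy.le, hy.2.trans hwx⟩ 1 ⟨hx.2, hwx⟩
  have hix3 := hi x hx 1 ⟨hx.2, hwx⟩ _ ⟨hx.2.trans hwx, le_rfl⟩
  have hiy1 := hi y hy y ⟨le_rfl, hy.2.trans hwy⟩ 1 ⟨hy.2, hwy⟩
  have hiy2 := hi y hy 1 ⟨hy.2, hwy⟩ _ ⟨hy.2.trans hwy, le_rfl⟩
  have hft : ∀ t ∈ Icc x 1, 0 < f p t := fun t ht => f_pos hp (hmem t ⟨hx.1.trans_le ht.1, ht.2⟩)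
  have hpos : 0 < ∫ t in x..y, 1 / √(f p t + 3 * f p x) := by
    refine intervalIntegral.intervalIntegral_pos_of_pos_on hix1 (fun t ht => ?_) hxy
    have := hft t ⟨ht.1.le, ht.2.le.trans hy.2⟩
    positivity
  have hmid : ∫ t in y..1, 1 / √(f p t + 3 * f p y) ≤ ∫ t in y..1, 1 / √(f p t + 3 * f p x) := by
    refine intervalIntegral.integral_mono_on hy.2 hiy1 hix2 fun t ht => ?_
    have := hft t ⟨hxy.le.trans ht.1, ht.2⟩
    gcongr
  have houter := outer_integral_anti hp (c := 3 * f p x) (d := 3 * f p y) (by linarith)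
    (by linarith) (by simpa only [neg_mul] using hix3) (by simpa only [neg_mul] using hiy2)
  simp only [← neg_mul] at houter
  rw [lengthIntegral, lengthIntegral, ← intervalIntegral.integral_add_adjacent_intervals hiy1 hiy2,
    ← intervalIntegral.integral_add_adjacent_intervals hix1 (hix2.trans hix3),
    ← intervalIntegral.integral_add_adjacent_intervals hix2 hix3]
  linarith

/-- The derivative of `q p`. -/
noncomputable def dq (p y : ℝ) : ℝ := ((p - 1) * fInv p y ^ (p - 2) - 1) * q p y ^ 3

lemma hasDerivAt_inv_q (hp : 2 < p) {y : ℝ} (hy : y < f p 1) :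
    HasDerivAt (fun y => fInv p y ^ (p - 1) - fInv p y)
      (-(((p - 1) * fInv p y ^ (p - 2) - 1) * q p y)) y := by
  have h := ((hasDerivAt_deriv_f (p := p) (zero_lt_one.trans (one_lt_fInv hp hy))).comp y
    (hasDerivAt_fInv hp hy)).neg
  refine (h.congr_of_eventuallyEq (.of_forall fun x => ?_)).congr_deriv (by ring)
  simp

lemma hasDerivAt_q (hp : 2 < p) {y : ℝ} (hy : y < f p 1) : HasDerivAt (q p) (dq p y) y := by
  have h0 := sub_pos.2 (lt_rpow_sub_one hp (one_lt_fInv hp hy))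
  refine ((hasDerivAt_inv_q hp hy).inv h0.ne').congr_deriv ?_
  rw [dq, q]
  field_simp

lemma continuousOn_q (hp : 2 < p) : ContinuousOn (q p) (Iio (f p 1)) :=
  fun _ hy => (hasDerivAt_q hp hy).continuousAt.continuousWithinAt

lemma continuousOn_dq (hp : 2 < p) : ContinuousOn (dq p) (Iio (f p 1)) := by
  have h1 : ContinuousOn (fInv p) (Iio (f p 1)) :=
    fun y hy => (continuousAt_fInv hp hy).continuousWithinAt
  have h2 : ContinuousOn (fun y => fInv p y ^ (p - 2)) (Iio (f p 1)) :=
    h1.rpow_const fun y hy => Or.inr (by linarith)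
  exact ((continuousOn_const.mul h2).sub continuousOn_const).mul ((continuousOn_q hp).pow 3)

lemma slope_factor_monotoneOn (hp : 2 < p) :
    MonotoneOn (fun y => ((p - 1) * fInv p y ^ (p - 2) - 1) * q p y) (Iio (f p 1)) := by
  have key : ∀ y ∈ Iio (f p 1), ((p - 1) * fInv p y ^ (p - 2) - 1) * q p y =
      (fInv p y)⁻¹ * (p - 1 + (p - 2) * (fInv p y ^ (p - 2) - 1)⁻¹) := by
    intro y hy
    have ht := one_lt_fInv hp hy
    have hx : 0 < fInv p y ^ (p - 2) - 1 := sub_pos.2 (Real.one_lt_rpow ht (by linarith))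
    rw [q, rpow_sub_one_eq _ (by linarith)]
    set t := fInv p y
    have : t * t ^ (p - 2) - t = t * (t ^ (p - 2) - 1) := by ring
    have ht0 : t ≠ 0 := by linarith
    rw [this]
    field_simp
    ring
  intro x hx y hy hxy
  simp only
  rw [key x hx, key y hy]
  have hle := (strictAntiOn_fInv hp).antitoneOn (mem_Iio.1 hx).le (mem_Iio.1 hy).le hxy
  have hx1 := one_lt_fInv hp hx
  have hy1 := one_lt_fInv hp hy
  have hxy' : fInv p y ^ (p - 2) ≤ fInv p x ^ (p - 2) :=
    Real.rpow_le_rpow (by linarith) hle (by linarith)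
  have hy2 : 1 < fInv p y ^ (p - 2) := Real.one_lt_rpow hy1 (by linarith)
  have hinv : (fInv p x ^ (p - 2) - 1)⁻¹ ≤ (fInv p y ^ (p - 2) - 1)⁻¹ :=
    inv_anti₀ (by linarith) (by linarith)
  have hinv0 : 0 ≤ (fInv p x ^ (p - 2) - 1)⁻¹ := inv_nonneg.2 (by linarith)
  have hp2 : 0 < p - 2 := by linarith
  refine mul_le_mul (inv_anti₀ (by linarith) hle) ?_ ?_ (inv_nonneg.2 (by linarith))
  · linarith [mul_le_mul_of_nonneg_left hinv hp2.le]
  · linarith [mul_nonneg hp2.le hinv0]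

/-- The tangent line inequality for the concave function `1 / q p`. -/
lemma dq_mul_sub_le (hp : 2 < p) {y a : ℝ} (hya : y ≤ a) (ha : a < f p 1) :
    dq p y * (a - y) ≤ q p y - q p y ^ 2 / q p a := by
  have hy := hya.trans_lt ha
  have hqy := q_pos hp hy
  have hqa := q_pos hp ha
  have hd : ∀ x ∈ Icc y a, HasDerivAt (fun y => fInv p y ^ (p - 1) - fInv p y)
      (-(((p - 1) * fInv p x ^ (p - 2) - 1) * q p x)) x :=
    fun x hx => hasDerivAt_inv_q hp (hx.2.trans_lt ha)
  have hmvt := (convex_Icc y a).image_sub_le_mul_sub_of_deriv_le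
    (fun x hx => (hd x hx).continuousAt.continuousWithinAt)
    (fun x hx => (hd x (interior_subset hx)).differentiableAt.differentiableWithinAt)
    (C := -(((p - 1) * fInv p y ^ (p - 2) - 1) * q p y))
    (fun x hx => by
      have hx' := interior_subset hx
      rw [(hd x hx').deriv]
      exact neg_le_neg (slope_factor_monotoneOn hp hy (hx'.2.trans_lt ha) hx'.1))
    y (left_mem_Icc.2 hya) a (right_mem_Icc.2 hya) hya
  have hinv : ∀ x, fInv p x ^ (p - 1) - fInv p x = (q p x)⁻¹ := fun x => (inv_inv _).symm
  simp only [hinv] at hmvt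
  have hmul := mul_le_mul_of_nonneg_left hmvt (sq_nonneg (q p y))
  have hcancel : q p y ^ 2 * ((q p a)⁻¹ - (q p y)⁻¹) = q p y ^ 2 / q p a - q p y := by
    field_simp
  rw [hcancel] at hmul
  rw [dq]
  linarith

/-- The integral in the length function for `z ∈ (1, (p / 2) ^ (1 / (p - 2)))`, as a function of
`a = f z`. -/
noncomputable def scaledIntegral (p a : ℝ) : ℝ :=
  ∫ s in (0 : ℝ)..1, 2 * √a * q p (a * (4 * s - 3)) * (√s)⁻¹

lemma lengthIntegral_eq_scaledIntegral (hp : 2 < p) {z : ℝ}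
    (hz : z ∈ Ioo 1 ((p / 2) ^ (1 / (p - 2)))) :
    lengthIntegral p z = scaledIntegral p (f p z) := by
  have h0 := f_pos hp ⟨zero_lt_one.trans hz.1, hz.2⟩
  have h4 : √4 = 2 := by rw [show (4 : ℝ) = 2 ^ 2 by norm_num, Real.sqrt_sq two_pos.le]
  have h := integral_radicand hp (a := -3 * f p z) (b := f p z) (c := 3 * f p z) (by linarith)
    (f_le_f_one hp (by linarith [hz.1])) (by ring)
  rw [fInv_f hp hz.1.le] at h
  rw [lengthIntegral, h, scaledIntegral, show f p z - -3 * f p z = 4 * f p z by ring,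
    Real.sqrt_mul (by norm_num), h4]
  simp only [show ∀ s, -3 * f p z + 4 * f p z * s = f p z * (4 * s - 3) from fun s => by ring]

/-- The derivative in `a` of the integrand of `scaledIntegral`, up to the factor `1 / √s`. -/
noncomputable def scaledDeriv (p a s : ℝ) : ℝ :=
  (√a)⁻¹ * q p (a * (4 * s - 3)) + 2 * √a * ((4 * s - 3) * dq p (a * (4 * s - 3)))

lemma mul_lt_f_one {a s : ℝ} (ha : a ∈ Ioo 0 (f p 1)) (hs : s ≤ 1) :
    a * (4 * s - 3) < f p 1 := by nlinarith [ha.1, ha.2]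

lemma hasDerivAt_scaled (hp : 2 < p) {a s : ℝ} (ha : a ∈ Ioo 0 (f p 1)) (hs : s ≤ 1) :
    HasDerivAt (fun a => 2 * √a * q p (a * (4 * s - 3)) * (√s)⁻¹)
      (scaledDeriv p a s * (√s)⁻¹) a := by
  have h1 := (Real.hasDerivAt_sqrt ha.1.ne').const_mul 2
  have h2 : HasDerivAt (fun a => q p (a * (4 * s - 3))) (dq p (a * (4 * s - 3)) * (4 * s - 3)) a :=
    HasDerivAt.comp (h₂ := q p) a (hasDerivAt_q hp (mul_lt_f_one ha hs))
      (by simpa using (hasDerivAt_id a).mul_const (4 * s - 3))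
  refine ((h1.mul h2).mul_const _).congr_deriv ?_
  have : 0 < √a := Real.sqrt_pos.2 ha.1
  rw [scaledDeriv]
  field_simp

lemma continuousOn_q_comp (hp : 2 < p) {a : ℝ} (ha : a ∈ Ioo 0 (f p 1)) :
    ContinuousOn (fun s => q p (a * (4 * s - 3))) (uIcc 0 1) := by
  refine (continuousOn_q hp).comp (by fun_prop) fun s hs => ?_
  rw [uIcc_of_le zero_le_one] at hs
  exact mul_lt_f_one ha hs.2

lemma continuousOn_dq_comp (hp : 2 < p) {a : ℝ} (ha : a ∈ Ioo 0 (f p 1)) :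
    ContinuousOn (fun s => dq p (a * (4 * s - 3))) (uIcc 0 1) := by
  refine (continuousOn_dq hp).comp (by fun_prop) fun s hs => ?_
  rw [uIcc_of_le zero_le_one] at hs
  exact mul_lt_f_one ha hs.2

lemma intervalIntegrable_scaled (hp : 2 < p) {a : ℝ} (ha : a ∈ Ioo 0 (f p 1)) :
    IntervalIntegrable (fun s => 2 * √a * q p (a * (4 * s - 3)) * (√s)⁻¹) volume 0 1 :=
  intervalIntegrable_inv_sqrt.continuousOn_mul (continuousOn_const.mul (continuousOn_q_comp hp ha))

lemma intervalIntegrable_scaledDeriv (hp : 2 < p) {a : ℝ} (ha : a ∈ Ioo 0 (f p 1)) :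
    IntervalIntegrable (fun s => scaledDeriv p a s * (√s)⁻¹) volume 0 1 := by
  refine intervalIntegrable_inv_sqrt.continuousOn_mul ?_
  have h1 := continuousOn_q_comp hp ha
  have h2 := continuousOn_dq_comp hp ha
  unfold scaledDeriv
  fun_prop

lemma hasDerivAt_scaledIntegral (hp : 2 < p) {a : ℝ} (ha : a ∈ Ioo 0 (f p 1)) :
    HasDerivAt (scaledIntegral p) (∫ s in (0 : ℝ)..1, scaledDeriv p a s * (√s)⁻¹) a := by
  obtain ⟨b, hab, hb⟩ := exists_between ha.2
  obtain ⟨l, hl, hla⟩ := exists_between ha.1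
  have hsub : Icc (-3 * b) b ⊆ Iio (f p 1) := fun y hy => hy.2.trans_lt hb
  obtain ⟨K, hK⟩ := isCompact_Icc.exists_bound_of_continuousOn ((continuousOn_q hp).mono hsub)
  obtain ⟨M, hM⟩ := isCompact_Icc.exists_bound_of_continuousOn ((continuousOn_dq hp).mono hsub)
  have hmem : ∀ x ∈ Ioo l b, x ∈ Ioo 0 (f p 1) := fun x hx => ⟨hl.trans hx.1, hx.2.trans hb⟩
  refine (intervalIntegral.hasDerivAt_integral_of_dominated_loc_of_deriv_le
    (s := Ioo l b) (F' := fun a s => scaledDeriv p a s * (√s)⁻¹)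
    (bound := fun s => ((√l)⁻¹ * K + 2 * √b * (3 * M)) * (√s)⁻¹)
    (Ioo_mem_nhds hla hab) ?_ (intervalIntegrable_scaled hp ha)
    (intervalIntegrable_scaledDeriv hp ha).def'.aestronglyMeasurable ?_
    (intervalIntegrable_inv_sqrt.const_mul _) ?_).2
  · filter_upwards [Ioo_mem_nhds hla hab] with x hx
    exact (intervalIntegrable_scaled hp (hmem x hx)).def'.aestronglyMeasurable
  · refine .of_forall fun s hs x hx => ?_
    rw [uIoc_of_le zero_le_one] at hs
    have hx0 : 0 < x := hl.trans hx.1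
    have hy : x * (4 * s - 3) ∈ Icc (-3 * b) b := by
      constructor <;> nlinarith [hs.1, hs.2, hx.2]
    have hq := hK _ hy
    have hdq := hM _ hy
    have hs3 : |4 * s - 3| ≤ 3 := abs_le.2 ⟨by linarith [hs.1], by linarith [hs.2]⟩
    rw [norm_mul, Real.norm_of_nonneg (inv_nonneg.2 (Real.sqrt_nonneg s))]
    refine mul_le_mul_of_nonneg_right ?_ (by positivity)
    rw [scaledDeriv]
    refine (norm_add_le _ _).trans (add_le_add ?_ ?_)
    · rw [norm_mul, Real.norm_of_nonneg (by positivity)]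
      have : (√x)⁻¹ ≤ (√l)⁻¹ := inv_anti₀ (Real.sqrt_pos.2 hl) (Real.sqrt_le_sqrt hx.1.le)
      exact mul_le_mul this hq (norm_nonneg _) (by positivity)
    · rw [norm_mul, norm_mul (4 * s - 3), Real.norm_of_nonneg (by positivity), Real.norm_eq_abs
        (4 * s - 3)]
      have : √x ≤ √b := Real.sqrt_le_sqrt hx.2.le
      exact mul_le_mul (by linarith) (mul_le_mul hs3 hdq (norm_nonneg _) (by norm_num))
        (by positivity) (by positivity)
  · refine .of_forall fun s hs x hx => ?_
    rw [uIoc_of_le zero_le_one] at hs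
    exact hasDerivAt_scaled hp (hmem x hx) hs.2

lemma integral_scaledDeriv_pos (hp : 2 < p) {a : ℝ} (ha : a ∈ Ioo 0 (f p 1)) :
    0 < ∫ s in (0 : ℝ)..1, scaledDeriv p a s * (√s)⁻¹ := by
  set g : ℝ → ℝ := fun s =>
    ((q p (a * (4 * s - 3)) - q p a) + 8 * a * s * dq p (a * (4 * s - 3))) * (√s)⁻¹ with hg
  have hq := continuousOn_q_comp hp ha
  have hdq := continuousOn_dq_comp hp ha
  have hgi : IntervalIntegrable g volume 0 1 :=
    intervalIntegrable_inv_sqrt.continuousOn_mul (by fun_prop)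
  have hg0 : ∫ s in (0 : ℝ)..1, g s = 0 := by
    rw [intervalIntegral.integral_eq_sub_of_hasDerivAt_of_le zero_le_one
      (f := fun s => 2 * √s * (q p (a * (4 * s - 3)) - q p a)) ?_ ?_ hgi]
    · norm_num
    · rw [uIcc_of_le zero_le_one] at hq
      have := Real.continuous_sqrt.continuousOn (s := Icc (0 : ℝ) 1)
      fun_prop
    · intro s hs
      have h1 := (Real.hasDerivAt_sqrt hs.1.ne').const_mul 2
      have hin : HasDerivAt (fun s => a * (4 * s - 3)) (a * 4) s := by
        simpa using (((hasDerivAt_id s).const_mul 4).sub_const 3).const_mul a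
      have h2 : HasDerivAt (fun s => q p (a * (4 * s - 3)))
          (dq p (a * (4 * s - 3)) * (a * 4)) s :=
        HasDerivAt.comp (h₂ := q p) s (hasDerivAt_q hp (mul_lt_f_one ha hs.2.le)) hin
      refine (h1.mul (h2.sub_const (q p a))).congr_deriv ?_
      have hs0 : 0 < √s := Real.sqrt_pos.2 hs.1
      have hss : √s ^ 2 = s := Real.sq_sqrt hs.1.le
      rw [hg]
      field_simp
      rw [hss]
      ring
  have hint := intervalIntegrable_scaledDeriv hp ha
  have hpos : 0 < ∫ s in (0 : ℝ)..1, (scaledDeriv p a s * (√s)⁻¹ - (4 * √a)⁻¹ * g s) := by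
    refine intervalIntegral.intervalIntegral_pos_of_pos_on (hint.sub (hgi.const_mul _))
      (fun s hs => ?_) zero_lt_one
    have hs0 : 0 < √s := Real.sqrt_pos.2 hs.1
    have ha0 : 0 < √a := Real.sqrt_pos.2 ha.1
    have haa : √a ^ 2 = a := Real.sq_sqrt ha.1.le
    have hy := mul_lt_f_one ha hs.2.le
    have htan := dq_mul_sub_le hp (y := a * (4 * s - 3)) (by nlinarith [hs.2, ha.1]) ha.2
    have hqa := q_pos hp ha.2
    have heq : scaledDeriv p a s * (√s)⁻¹ - (4 * √a)⁻¹ * g s =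
        (4 * √a * √s)⁻¹ * (3 * q p (a * (4 * s - 3)) + q p a -
          6 * (dq p (a * (4 * s - 3)) * (a - a * (4 * s - 3)))) := by
      rw [hg, scaledDeriv]
      field_simp
      rw [haa]
      ring
    rw [heq]
    refine mul_pos (by positivity) ?_
    generalize q p (a * (4 * s - 3)) = x at *
    generalize q p a = r at *
    have hquad : 0 < r - 3 * x + 6 * (x ^ 2 / r) := by
      have : r - 3 * x + 6 * (x ^ 2 / r) = (r ^ 2 - 3 * x * r + 6 * x ^ 2) / r := by
        field_simp
      rw [this]
      exact div_pos (by nlinarith [sq_nonneg (3 * r - 6 * x), sq_nonneg x, sq_pos_of_pos hqa]) hqa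
    linarith
  rw [intervalIntegral.integral_sub hint (hgi.const_mul _),
    intervalIntegral.integral_const_mul, hg0, mul_zero, sub_zero] at hpos
  exact hpos

lemma strictAntiOn_lengthIntegral_Icc (hp : 2 < p) :
    StrictAntiOn (lengthIntegral p) (Icc 1 ((p / 2) ^ (1 / (p - 2)))) := by
  refine strictAntiOn_of_deriv_neg (convex_Icc _ _)
    ((continuousOn_lengthIntegral hp).mono fun z hz => ⟨zero_lt_one.trans_le hz.1, hz.2⟩)
    fun z hz => ?_
  rw [interior_Icc] at hz
  have ha : f p z ∈ Ioo 0 (f p 1) := ⟨f_pos hp ⟨zero_lt_one.trans hz.1, hz.2⟩,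
    strictAntiOn_f hp self_mem_Ici hz.1.le hz.1⟩
  have hd := (hasDerivAt_scaledIntegral hp ha).comp z (hasDerivAt_f hp z)
  have heq : lengthIntegral p =ᶠ[𝓝 z] scaledIntegral p ∘ f p := by
    filter_upwards [Ioo_mem_nhds hz.1 hz.2] with x hx
    exact lengthIntegral_eq_scaledIntegral hp hx
  rw [(hd.congr_of_eventuallyEq heq).deriv]
  exact mul_neg_of_pos_of_neg (integral_scaledDeriv_pos hp ha)
    (sub_neg.2 (lt_rpow_sub_one hp hz.1))

lemma strictAntiOn_lengthIntegral (hp : 2 < p) :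
    StrictAntiOn (lengthIntegral p) (Ioc 0 ((p / 2) ^ (1 / (p - 2)))) := by
  have hZ := (one_lt_zero_point hp).le
  rw [← Ioc_union_Icc_eq_Ioc zero_lt_one hZ]
  exact (strictAntiOn_lengthIntegral_Ioc hp).union (strictAntiOn_lengthIntegral_Icc hp)
    (isGreatest_Ioc zero_lt_one) (isLeast_Icc hZ)

lemma neg_log_le_lengthIntegral (hp : 2 < p) {z : ℝ} (hz : z ∈ Ioo (0 : ℝ) 1) :
    (√2)⁻¹ * -Real.log z ≤ lengthIntegral p z := by
  have hz' : z ∈ Ioo (0 : ℝ) ((p / 2) ^ (1 / (p - 2))) := ⟨hz.1, hz.2.trans (one_lt_zero_point hp)⟩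
  have hw := ((le_max_right z 1).trans_lt (lt_fInv hp hz')).le
  have hi := integrable_integrand hp hz'
  have hzw := hz.2.le.trans hw
  have hi1 : IntervalIntegrable (fun t => 1 / √(f p t + 3 * f p z)) volume z 1 :=
    hi.mono_set (by rw [uIcc_of_le hz.2.le, uIcc_of_le hzw]; exact Icc_subset_Icc_right hw)
  have hi2 : IntervalIntegrable (fun t => 1 / √(f p t + 3 * f p z)) volume 1
      (fInv p (-3 * f p z)) :=
    hi.mono_set (by rw [uIcc_of_le hw, uIcc_of_le hzw]; exact Icc_subset_Icc_left hz.2.le)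
  have h0mem : (0 : ℝ) ∉ uIcc z 1 := by
    rw [uIcc_of_le hz.2.le]; exact fun h => (hz.1.trans_le h.1).false
  have hlog : ∫ t in z..1, (√2)⁻¹ * t⁻¹ = (√2)⁻¹ * -Real.log z := by
    rw [intervalIntegral.integral_const_mul, integral_inv h0mem, one_div, Real.log_inv]
  rw [lengthIntegral, ← intervalIntegral.integral_add_adjacent_intervals hi1 hi2, ← hlog]
  have h2 : 0 ≤ ∫ t in (1 : ℝ)..fInv p (-3 * f p z), 1 / √(f p t + 3 * f p z) :=
    intervalIntegral.integral_nonneg hw fun t _ => by positivity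
  refine le_add_of_le_of_nonneg (intervalIntegral.integral_mono_on hz.2.le
    ((intervalIntegral.intervalIntegrable_inv (fun t ht => ne_of_mem_of_not_mem ht h0mem)
      continuousOn_id).const_mul _) hi1 fun t ht => ?_) h2
  have ht0 : 0 < t := hz.1.trans_le ht.1
  have hft := f_pos hp ⟨ht0, ht.2.trans_lt (one_lt_zero_point hp)⟩
  have hfz := f_pos hp hz'
  have hup : ∀ x : ℝ, 0 < x → f p x ≤ x ^ 2 / 2 := fun x hx =>
    sub_le_self _ (div_nonneg (Real.rpow_nonneg hx.le p) (by linarith))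
  have hsq : f p t + 3 * f p z ≤ 2 * t ^ 2 := by
    have := pow_le_pow_left₀ hz.1.le ht.1 2
    linarith [hup t ht0, hup z hz.1]
  rw [← mul_inv, one_div]
  refine inv_anti₀ (Real.sqrt_pos.2 (by positivity)) ?_
  calc √(f p t + 3 * f p z) ≤ √(2 * t ^ 2) := Real.sqrt_le_sqrt hsq
    _ = √2 * t := by rw [Real.sqrt_mul two_pos.le, Real.sqrt_sq ht0.le]

lemma tendsto_lengthIntegral (hp : 2 < p) : Tendsto (lengthIntegral p) (𝓝[>] 0) atTop := by
  have hlim : Tendsto (fun z => (√2)⁻¹ * -Real.log z) (𝓝[>] 0) atTop :=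
    (tendsto_neg_atBot_atTop.comp Real.tendsto_log_nhdsGT_zero).const_mul_atTop (by positivity)
  refine tendsto_atTop_mono' _ ?_ hlim
  filter_upwards [Ioo_mem_nhdsGT zero_lt_one] with z hz
  exact neg_log_le_lengthIntegral hp hz

end LengthFunction

/-- for every `p > 2`, the length function
`L(z) = (1/√2) ∫_z^{w(z)} dt/√(f(t)+3f(z))` (with `w(z) ∈ [1,∞)` the unique point where
`f(w(z)) = -3 f(z)`) is positive on `(0, (p/2)^(1/(p-2)))`, continuous and strictly
decreasing on `(0, (p/2)^(1/(p-2))]`, vanishes at `(p/2)^(1/(p-2))`, and tends to `+∞`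
as `z → 0⁺`. -/
theorem stmt_6 (p : ℝ) (hp : 2 < p) (w : ℝ → ℝ)
    (hw : ∀ z ∈ Set.Ioc (0 : ℝ) ((p / 2) ^ (1 / (p - 2))),
      1 ≤ w z ∧ f p (w z) = -3 * f p z)
    (L : ℝ → ℝ)
    (hL : ∀ z ∈ Set.Ioc (0 : ℝ) ((p / 2) ^ (1 / (p - 2))),
      L z = (1 / Real.sqrt 2) * ∫ t in z..(w z), 1 / Real.sqrt (f p t + 3 * f p z)) :
    (∀ z ∈ Set.Ioo (0 : ℝ) ((p / 2) ^ (1 / (p - 2))), 0 < L z) ∧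
    ContinuousOn L (Set.Ioc (0 : ℝ) ((p / 2) ^ (1 / (p - 2)))) ∧
    StrictAntiOn L (Set.Ioc (0 : ℝ) ((p / 2) ^ (1 / (p - 2)))) ∧
    L ((p / 2) ^ (1 / (p - 2))) = 0 ∧
    Filter.Tendsto L (nhdsWithin 0 (Set.Ioi 0)) Filter.atTop := by
  have hZ := LengthFunction.one_lt_zero_point hp
  have hZ0 := zero_lt_one.trans hZ
  have hLI : Set.EqOn L (fun z => 1 / √2 * LengthFunction.lengthIntegral p z)
      (Set.Ioc (0 : ℝ) ((p / 2) ^ (1 / (p - 2)))) := by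
    intro z hz
    simp only
    rw [hL z hz, LengthFunction.lengthIntegral, ← (hw z hz).2,
      LengthFunction.fInv_f hp (hw z hz).1]
  have hc : 0 < 1 / √2 := by positivity
  have hanti : StrictAntiOn L (Set.Ioc (0 : ℝ) ((p / 2) ^ (1 / (p - 2)))) := by
    intro x hx y hy hxy
    rw [hLI hx, hLI hy]
    exact mul_lt_mul_of_pos_left (LengthFunction.strictAntiOn_lengthIntegral hp hx hy hxy) hc
  have hzero : L ((p / 2) ^ (1 / (p - 2))) = 0 := by
    rw [hLI ⟨hZ0, le_rfl⟩]
    simp only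
    rw [LengthFunction.lengthIntegral_zero_point hp, mul_zero]
  refine ⟨fun z hz => ?_, ?_, hanti, hzero, ?_⟩
  · rw [← hzero]
    exact hanti ⟨hz.1, hz.2.le⟩ ⟨hZ0, le_rfl⟩ hz.2
  · exact ((LengthFunction.continuousOn_lengthIntegral hp).const_mul _).congr hLI
  · refine ((LengthFunction.tendsto_lengthIntegral hp).const_mul_atTop hc).congr' ?_
    filter_upwards [Ioo_mem_nhdsGT hZ0] with z hz
    exact (hLI ⟨hz.1, hz.2.le⟩).symm
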